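/- Let n be even and let p : ZMod n → ℝ² be points with Σ_{k=1}^{n} (−1)^k p_k ≠ 0 (the alternating sum taken over representatives 1, …, n). Then there is no closed polygonal curve q : ZMod n → ℝ² satisfying the midpoint property with respect to p. -/

import Mathlib

noncomputable section

/-- The plane. -/
abbrev E2 := EuclideanSpace ℝ (Fin 2)

/-- A closed polygonal curve `q : ZMod n → E2` satisfies the midpoint property with
respect to `p : ZMod n → E2` if `p k` is the midpoint of `q (k-1)` and `q k` for all `k`. -/
def MidpointProperty (n : ℕ) (p q : ZMod n → E2) : Prop :=
  ∀ k : ZMod n, p k = midpoint ℝ (q (k - 1)) (q k)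

/-- Under the midpoint property, the alternating partial sums of `p` telescope. -/
theorem MidpointProperty.sum_Icc_alternating {n : ℕ} {p q : ZMod n → E2}
    (h : MidpointProperty n p q) (m : ℕ) :
    ∑ k ∈ Finset.Icc 1 m, ((-1 : ℝ)) ^ k • p (k : ZMod n) =
      (2⁻¹ : ℝ) • (((-1 : ℝ)) ^ m • q (m : ZMod n) - q 0) := by
  induction m with
  | zero => simp
  | succ m ih =>
    rw [Finset.sum_Icc_succ_top (by omega), ih, h, midpoint_eq_smul_add, invOf_eq_inv,
      Nat.cast_succ, add_sub_cancel_right, pow_succ]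
    module

theorem stmt2 (n : ℕ) (hn : Even n) (p : ZMod n → E2)
    (hp : ∑ k ∈ Finset.Icc 1 n, ((-1 : ℝ)) ^ k • p (k : ZMod n) ≠ 0) :
    ¬ ∃ q : ZMod n → E2, MidpointProperty n p q := by
  rintro ⟨q, hq⟩
  apply hp
  rw [hq.sum_Icc_alternating, hn.neg_one_pow, ZMod.natCast_self, one_smul, sub_self, smul_zero]
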